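/- arXiv:2211.00696 — 2 statements merged into one kernel-verified Lean document; each statement's English description precedes it below -/
import Mathlib

section
/- For every square complex matrix A (of any size N×N) and every integer p ≥ 0, the φ-functions satisfy the recurrence relation φ_p(A) = A · φ_{p+1}(A) + (1/p!) · I, where I is the N×N identity matrix. -/
open scoped Nat

attribute [local instance] Matrix.linftyOpNormedAddCommGroup Matrix.linftyOpNormedSpace

/-- The `φ`-functions of a square complex matrix: `φ₀(A) = e^A` and, for `p ≥ 1`,
`φ_p(A) = ∫_0^1 e^{(1-θ)A} θ^{p-1}/(p-1)! dθ`. -/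
noncomputable def phi {N : ℕ} (p : ℕ) (A : Matrix (Fin N) (Fin N) ℂ) :
    Matrix (Fin N) (Fin N) ℂ :=
  if p = 0 then NormedSpace.exp A
  else ∫ θ in (0:ℝ)..1, (θ ^ (p - 1) / (p - 1)! : ℝ) • NormedSpace.exp ((1 - θ) • A)

section BanachAlgebra

variable {𝔸 : Type*} [NormedRing 𝔸] [NormedAlgebra ℝ 𝔸] [CompleteSpace 𝔸]

theorem hasDerivAt_exp_one_sub_smul (a : 𝔸) (t : ℝ) :
    HasDerivAt (fun θ : ℝ => NormedSpace.exp ((1 - θ) • a))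
      (-(a * NormedSpace.exp ((1 - t) • a))) t := by
  have h := (hasDerivAt_exp_smul_const' (𝕂 := ℝ) a (1 - t)).scomp t
    ((hasDerivAt_id t).const_sub 1)
  rw [neg_one_smul] at h
  exact h

theorem continuous_exp_one_sub_smul (a : 𝔸) :
    Continuous fun θ : ℝ => NormedSpace.exp ((1 - θ) • a) :=
  continuous_iff_continuousAt.2 fun t => (hasDerivAt_exp_one_sub_smul a t).continuousAt

/-- Integration by parts against `θ ↦ e^{(1-θ)a}`. -/
theorem integral_deriv_smul_exp_one_sub_smul (a : 𝔸) {w w' : ℝ → ℝ}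
    (hw : ∀ t, HasDerivAt w (w' t) t) (hw' : Continuous w') :
    ∫ θ in (0:ℝ)..1, w' θ • NormedSpace.exp ((1 - θ) • a) =
      a * (∫ θ in (0:ℝ)..1, w θ • NormedSpace.exp ((1 - θ) • a)) +
        (w 1 • (1 : 𝔸) - w 0 • NormedSpace.exp a) := by
  have hE := continuous_exp_one_sub_smul a
  have hwc : Continuous w := continuous_iff_continuousAt.2 fun t => (hw t).continuousAt
  have hI : a * (∫ θ in (0:ℝ)..1, w θ • NormedSpace.exp ((1 - θ) • a)) =
      ∫ θ in (0:ℝ)..1, a * (w θ • NormedSpace.exp ((1 - θ) • a)) :=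
    ((ContinuousLinearMap.mul ℝ 𝔸 a).intervalIntegral_comp_comm
      ((hwc.smul hE).intervalIntegrable 0 1)).symm
  have key := intervalIntegral.integral_eq_sub_of_hasDerivAt (a := 0) (b := 1)
    (fun t _ => (hw t).smul (hasDerivAt_exp_one_sub_smul a t))
    (Continuous.intervalIntegrable
      ((hwc.smul (continuous_const.mul hE).neg).add (hw'.smul hE)) 0 1)
  rw [intervalIntegral.integral_add (f := fun t => w t • -(a * NormedSpace.exp ((1 - t) • a)))
    (g := fun t => w' t • NormedSpace.exp ((1 - t) • a))
    ((hwc.smul (continuous_const.mul hE).neg).intervalIntegrable 0 1)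
    ((hw'.smul hE).intervalIntegrable 0 1)] at key
  simp only [smul_neg, intervalIntegral.integral_neg, ← mul_smul_comm, ← hI, Pi.smul_apply',
    sub_self, zero_smul, NormedSpace.exp_zero, sub_zero, one_smul] at key
  rw [← key]
  abel

theorem integral_exp_one_sub_smul (a : 𝔸) :
    NormedSpace.exp a =
      a * (∫ θ in (0:ℝ)..1, NormedSpace.exp ((1 - θ) • a)) + 1 := by
  have h := integral_deriv_smul_exp_one_sub_smul a (w := fun _ => 1) (w' := fun _ => 0)
    (fun t => hasDerivAt_const t 1) continuous_const
  simp only [zero_smul, one_smul, intervalIntegral.integral_zero] at h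
  rw [← sub_eq_zero, ← neg_eq_zero, h]
  abel

theorem integral_pow_div_factorial_smul_exp (a : 𝔸) (p : ℕ) :
    ∫ θ in (0:ℝ)..1, (θ ^ p / p ! : ℝ) • NormedSpace.exp ((1 - θ) • a) =
      a * (∫ θ in (0:ℝ)..1, (θ ^ (p + 1) / (p + 1)! : ℝ) • NormedSpace.exp ((1 - θ) • a)) +
        ((p + 1)! : ℝ)⁻¹ • (1 : 𝔸) := by
  have h := integral_deriv_smul_exp_one_sub_smul a
    (w := fun θ => θ ^ (p + 1) / (p + 1)!) (w' := fun θ => θ ^ p / p !)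
    (fun t => by
      refine ((hasDerivAt_pow (p + 1) t).div_const ((p + 1)! : ℝ)).congr_deriv ?_
      rw [Nat.factorial_succ]
      push_cast
      have : (p ! : ℝ) ≠ 0 := by positivity
      have : (p : ℝ) + 1 ≠ 0 := by positivity
      field_simp)
    (by fun_prop)
  simpa using h

end BanachAlgebra

attribute [local instance] Matrix.linftyOpNormedRing Matrix.linftyOpNormedAlgebra in
theorem phi_eq_mul_phi_succ_add {N : ℕ} (A : Matrix (Fin N) (Fin N) ℂ) (p : ℕ) :
    phi p A = A * phi (p + 1) A + ((p ! : ℂ))⁻¹ • (1 : Matrix (Fin N) (Fin N) ℂ) := by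
  have hs (q : ℕ) : ((q ! : ℂ))⁻¹ • (1 : Matrix (Fin N) (Fin N) ℂ) =
      ((q ! : ℝ))⁻¹ • (1 : Matrix (Fin N) (Fin N) ℂ) := by
    rw [← Complex.coe_smul]
    push_cast
    rfl
  rw [hs]
  cases p with
  | zero =>
    simp only [phi, one_ne_zero, if_true, if_false, zero_add,
      Nat.sub_self, pow_zero, Nat.factorial_zero, Nat.cast_one, div_one, one_smul, inv_one]
    exact integral_exp_one_sub_smul A
  | succ p =>
    simp only [phi, Nat.add_eq_zero_iff, one_ne_zero, and_false, if_false, Nat.add_sub_cancel]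
    exact integral_pow_div_factorial_smul_exp A p

/-- The recurrence `φ_p(A) = A φ_{p+1}(A) + (1/p!) I` for all `p ≥ 0`. -/
theorem phi_recurrence {N : ℕ} (A : Matrix (Fin N) (Fin N) ℂ) (p : ℕ) :
    phi p A = A * phi (p + 1) A + ((p ! : ℂ))⁻¹ • (1 : Matrix (Fin N) (Fin N) ℂ) :=
  phi_eq_mul_phi_succ_add A p
end

section
/- For every square complex matrix A and every integer p ≥ 1, the modified squaring identity holds: φ_p(2A) = 2^{-p} ( e^{A} · φ_p(A) + ∑_{j=1}^{p} (1/(p-j)!) · φ_j(A) ). -/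
open scoped Nat

attribute [local instance] Matrix.linftyOpNormedAddCommGroup Matrix.linftyOpNormedSpace

/-- The defining integral of `phi (q + 1) A`, without truncated subtraction. -/
theorem phi_succ {N : ℕ} (q : ℕ) (A : Matrix (Fin N) (Fin N) ℂ) :
    phi (q + 1) A =
      ∫ θ in (0:ℝ)..1, (θ ^ q / q ! : ℝ) • NormedSpace.exp ((1 - θ) • A) := by
  simp [phi]

theorem continuous_exp_smul {N : ℕ} (A : Matrix (Fin N) (Fin N) ℂ) :
    Continuous fun θ : ℝ => NormedSpace.exp ((1 - θ) • A) := by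
  let _ : NormedRing (Matrix (Fin N) (Fin N) ℂ) := Matrix.linftyOpNormedRing
  let _ : NormedAlgebra ℂ (Matrix (Fin N) (Fin N) ℂ) := Matrix.linftyOpNormedAlgebra
  let _ : NormedAlgebra ℚ (Matrix (Fin N) (Fin N) ℂ) := NormedAlgebra.restrictScalars ℚ ℂ _
  exact NormedSpace.exp_continuous.comp (by fun_prop)

theorem const_mul_intervalIntegral {N : ℕ} (B : Matrix (Fin N) (Fin N) ℂ)
    {f : ℝ → Matrix (Fin N) (Fin N) ℂ} (hf : Continuous f) (a b : ℝ) :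
    B * ∫ θ in a..b, f θ = ∫ θ in a..b, B * f θ := by
  let _ : NormedRing (Matrix (Fin N) (Fin N) ℂ) := Matrix.linftyOpNormedRing
  let _ : NormedAlgebra ℂ (Matrix (Fin N) (Fin N) ℂ) := Matrix.linftyOpNormedAlgebra
  exact ((ContinuousLinearMap.mul ℂ _ B).intervalIntegral_comp_comm
    (hf.intervalIntegrable a b)).symm

/-- The binomial theorem with factorial weights. -/
theorem one_add_pow_div_factorial (q : ℕ) (t : ℝ) :
    (1 + t) ^ q / q ! = ∑ k ∈ Finset.range (q + 1), ((q - k)! : ℝ)⁻¹ * (t ^ k / k !) := by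
  rw [add_comm, add_pow, Finset.sum_div]
  refine Finset.sum_congr rfl fun k hk => ?_
  rw [Nat.cast_choose ℝ (Nat.lt_succ_iff.mp (Finset.mem_range.mp hk))]
  have := Nat.factorial_ne_zero q
  field_simp
  simp

/-- The modified squaring identity
`φ_p(2A) = 2⁻ᵖ (e^A φ_p(A) + ∑_{j=1}^p (1/(p-j)!) φ_j(A))` for `p ≥ 1`. -/
theorem phi_two_smul {N : ℕ} (A : Matrix (Fin N) (Fin N) ℂ) (p : ℕ) (hp : 1 ≤ p) :
    phi p (2 • A) = (((2 : ℂ) ^ p)⁻¹) •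
      (NormedSpace.exp A * phi p A
        + ∑ j ∈ Finset.Icc 1 p, (((p - j)! : ℂ))⁻¹ • phi j A) := by
  obtain ⟨q, rfl⟩ := Nat.exists_eq_add_of_le' hp
  have hcont : ∀ w : ℝ → ℝ, Continuous w → ∀ B : Matrix (Fin N) (Fin N) ℂ,
      Continuous fun θ : ℝ => w θ • NormedSpace.exp ((1 - θ) • B) :=
    fun w hw B => hw.smul (continuous_exp_smul B)
  have hscale : ∀ X : Matrix (Fin N) (Fin N) ℂ,
      (((2 : ℂ) ^ (q + 1))⁻¹) • X = (((2 : ℝ) ^ (q + 1))⁻¹) • X := fun X => by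
    rw [← Complex.coe_smul]
    push_cast
    rfl
  have hleft : ∫ θ in (0:ℝ)..(1 / 2), (θ ^ q / q ! : ℝ) • NormedSpace.exp ((1 - θ) • (2 • A))
      = (((2 : ℝ) ^ (q + 1))⁻¹) • (NormedSpace.exp A * phi (q + 1) A) := by
    have hsub := intervalIntegral.inv_smul_integral_comp_div (a := 0) (b := 1)
      (fun θ : ℝ => (θ ^ q / q ! : ℝ) • NormedSpace.exp ((1 - θ) • (2 • A))) 2
    rw [zero_div] at hsub
    rw [← hsub, phi_succ, const_mul_intervalIntegral _ (hcont _ (by fun_prop) A),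
      ← intervalIntegral.integral_smul, ← intervalIntegral.integral_smul]
    congr 1
    funext t
    have hexp : NormedSpace.exp ((1 - t / 2) • (2 • A))
        = NormedSpace.exp A * NormedSpace.exp ((1 - t) • A) := by
      rw [← Matrix.exp_add_of_commute _ _ ((Commute.refl A).smul_right _)]
      congr 1
      module
    rw [hexp, mul_smul_comm, smul_smul, smul_smul]
    congr 1
    rw [div_pow, pow_succ]
    field_simp
  have hright : ∫ θ in (1 / 2 : ℝ)..1, (θ ^ q / q ! : ℝ) • NormedSpace.exp ((1 - θ) • (2 • A))
      = (((2 : ℝ) ^ (q + 1))⁻¹) •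
        ∑ k ∈ Finset.range (q + 1), ((q - k)! : ℝ)⁻¹ • phi (k + 1) A := by
    have hsub := intervalIntegral.inv_smul_integral_comp_add_div (a := 0) (b := 1)
      (fun θ : ℝ => (θ ^ q / q ! : ℝ) • NormedSpace.exp ((1 - θ) • (2 • A))) 2 (1 / 2)
    rw [zero_div, add_zero, add_halves] at hsub
    simp_rw [phi_succ, ← intervalIntegral.integral_smul]
    have hterm : ∀ k : ℕ, Continuous fun t : ℝ =>
        ((q - k)! : ℝ)⁻¹ • (t ^ k / k ! : ℝ) • NormedSpace.exp ((1 - t) • A) := fun k => by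
      simp_rw [smul_smul]
      exact hcont _ (by fun_prop) A
    rw [← intervalIntegral.integral_finsetSum fun k _ => (hterm k).intervalIntegrable _ _,
      ← hsub, ← intervalIntegral.integral_smul, ← intervalIntegral.integral_smul]
    congr 1
    funext t
    have hexp : (1 - (1 / 2 + t / 2)) • (2 • A) = (1 - t) • A := by module
    simp_rw [hexp, smul_smul, ← Finset.sum_smul, smul_smul, ← one_add_pow_div_factorial]
    congr 1
    rw [← add_div, div_pow, pow_succ]
    field_simp
  have hsum : ∑ j ∈ Finset.Icc 1 (q + 1), (((q + 1 - j)! : ℂ))⁻¹ • phi j A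
      = ∑ k ∈ Finset.range (q + 1), ((q - k)! : ℝ)⁻¹ • phi (k + 1) A := by
    rw [← Finset.Ico_add_one_right_eq_Icc, Finset.sum_Ico_eq_sum_range]
    refine Finset.sum_congr (by simp) fun k _ => ?_
    rw [← Complex.coe_smul, add_comm 1 k, Nat.add_sub_add_right]
    push_cast
    rfl
  rw [hscale, hsum, smul_add, ← hleft, ← hright, phi_succ,
    intervalIntegral.integral_add_adjacent_intervals] <;>
  exact (hcont _ (by fun_prop) _).intervalIntegrable _ _
end
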